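/- arXiv:1903.06091 — 5 statements merged into one kernel-verified Lean document; each statement's English description precedes it below -/
import Mathlib

section
/- Let T be a compact metric space and H a real Hilbert space of continuous real-valued functions on T, continuously embedded in C(T). Let f ∈ H and C_f := {h ∈ H : h(t) ≥ f(t) for all t ∈ T}, which is a nonempty closed convex subset of H, and let f̃ be the unique element of minimal H-norm in C_f (the metric projection of 0 onto C_f). Then ⟨f − f̃, f̃⟩_H = 0. -/
open scoped RealInnerProductSpace

/-- If moving from `x` along `d` by any parameter `s ≤ 1` does not decrease the norm, then `d` is
orthogonal to `x`. -/
theorem inner_eq_zero_of_norm_le_norm_add_smul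
    {E : Type*} [NormedAddCommGroup E] [InnerProductSpace ℝ E] {x d : E}
    (h : ∀ s : ℝ, s ≤ 1 → ‖x‖ ≤ ‖x + s • d‖) : ⟪d, x⟫ = 0 := by
  have quad : ∀ s : ℝ, s ≤ 1 → 0 ≤ 2 * s * ⟪d, x⟫ + s ^ 2 * ‖d‖ ^ 2 := by
    intro s hs
    have h₁ := pow_le_pow_left₀ (norm_nonneg x) (h s hs) 2
    rw [norm_add_sq_real, real_inner_smul_right, norm_smul, mul_pow, Real.norm_eq_abs, sq_abs,
      real_inner_comm] at h₁
    linarith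
  set a := ⟪d, x⟫
  set c := |a| + ‖d‖ ^ 2 + 1 with hc
  have hcpos : 0 < c := by positivity
  have hs : -a / c ≤ 1 := by
    rw [div_le_one hcpos]
    nlinarith [neg_le_abs a, sq_nonneg ‖d‖]
  have key : 0 ≤ a ^ 2 * (‖d‖ ^ 2 - 2 * c) := by
    have h₂ := mul_nonneg (quad _ hs) (sq_nonneg c)
    have h₃ : (2 * (-a / c) * a + (-a / c) ^ 2 * ‖d‖ ^ 2) * c ^ 2 =
        a ^ 2 * (‖d‖ ^ 2 - 2 * c) := by
      field_simp
      ring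
    rwa [h₃] at h₂
  have hneg : ‖d‖ ^ 2 - 2 * c < 0 := by
    linarith [abs_nonneg a, sq_nonneg ‖d‖]
  exact pow_eq_zero_iff two_ne_zero |>.1
    (le_antisymm (nonpos_of_mul_nonneg_left key hneg) (sq_nonneg a))

/-- Let `T` be a compact metric space and `H` a real Hilbert space of
continuous real-valued functions on `T`, continuously embedded in `C(T, ℝ)`. For `f ∈ H`
let `C_f = {h ∈ H : h ≥ f pointwise}` and let `f̃` be the element of minimal norm in `C_f`
(the metric projection of `0` onto `C_f`). Then `⟪f − f̃, f̃⟫_H = 0`. -/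
theorem inner_sub_proj_eq_zero
    (T : Type*) [MetricSpace T] [CompactSpace T]
    (H : Type*) [NormedAddCommGroup H] [InnerProductSpace ℝ H] [CompleteSpace H]
    (ι : H →L[ℝ] ContinuousMap T ℝ)
    (hinj : Function.Injective ι)
    (f ftilde : H)
    (hmem : ftilde ∈ {g : H | ∀ t : T, ι f t ≤ ι g t})
    (hmin : ∀ h ∈ {g : H | ∀ t : T, ι f t ≤ ι g t}, ‖ftilde‖ ≤ ‖h‖) :
    @inner ℝ H _ (f - ftilde) ftilde = 0 := by
  refine inner_eq_zero_of_norm_le_norm_add_smul fun s hs => hmin _ fun t => ?_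
  have ht : ι f t ≤ ι ftilde t := hmem t
  simp only [map_add, map_smul, map_sub, ContinuousMap.add_apply, ContinuousMap.smul_apply,
    ContinuousMap.sub_apply, smul_eq_mul]
  nlinarith [mul_nonneg (sub_nonneg.2 hs) (sub_nonneg.2 ht)]
end

section
/- Let T be a compact metric space and H a real Hilbert space of continuous real-valued functions on T, continuously embedded in C(T). Let f ∈ H, C_f := {h ∈ H : h(t) ≥ f(t) for all t ∈ T}, and let f̃ be the unique element of minimal H-norm in C_f. Then for every k ∈ H with k(t) ≥ 0 for all t ∈ T, one has ⟨f̃, k⟩_H ≥ 0. -/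
/-- If moving from `x` in the direction `k` never decreases the norm, then `⟪x, k⟫ ≥ 0`. -/
theorem inner_nonneg_of_norm_le_norm_add_smul {E : Type*} [NormedAddCommGroup E]
    [InnerProductSpace ℝ E] {x k : E} (h : ∀ s : ℝ, 0 ≤ s → ‖x‖ ≤ ‖x + s • k‖) :
    0 ≤ inner ℝ x k := by
  by_contra! ha
  set a := inner ℝ x k with ha_def
  have hb : 0 < ‖k‖ ^ 2 + 1 := by positivity
  obtain ⟨s, hs⟩ : ∃ s, s = -a / (‖k‖ ^ 2 + 1) := ⟨_, rfl⟩
  have hs_pos : 0 < s := hs ▸ div_pos (neg_pos.mpr ha) hb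
  have hsb : s * (‖k‖ ^ 2 + 1) = -a := by rw [hs]; field_simp
  have hsq : ‖x‖ ^ 2 ≤ ‖x + s • k‖ ^ 2 := by gcongr; exact h s hs_pos.le
  rw [norm_add_sq_real, inner_smul_right, norm_smul, Real.norm_of_nonneg hs_pos.le,
    ← ha_def] at hsq
  nlinarith [mul_pos hs_pos hs_pos, mul_neg_of_pos_of_neg hs_pos ha]

/-- Let `T` be a compact metric space and `H` a real Hilbert space of
continuous real-valued functions on `T`, continuously embedded in `C(T, ℝ)`. For `f ∈ H`
let `C_f = {h ∈ H : h ≥ f pointwise}` and let `f̃` be the element of minimal norm in `C_f`.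
Then for every `k ∈ H` with `k ≥ 0` pointwise, `⟪f̃, k⟫_H ≥ 0`. -/
theorem inner_proj_nonneg
    (T : Type*) [MetricSpace T] [CompactSpace T]
    (H : Type*) [NormedAddCommGroup H] [InnerProductSpace ℝ H] [CompleteSpace H]
    (ι : H →L[ℝ] ContinuousMap T ℝ)
    (hinj : Function.Injective ι)
    (f ftilde : H)
    (hmem : ftilde ∈ {g : H | ∀ t : T, ι f t ≤ ι g t})
    (hmin : ∀ h ∈ {g : H | ∀ t : T, ι f t ≤ ι g t}, ‖ftilde‖ ≤ ‖h‖) :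
    ∀ k : H, (∀ t : T, 0 ≤ ι k t) → 0 ≤ @inner ℝ H _ ftilde k := by
  intro k hk
  refine inner_nonneg_of_norm_le_norm_add_smul fun s hs => hmin _ fun t => ?_
  simpa using add_le_add (hmem t) (mul_nonneg hs (hk t))
end

section
/- Let T be a locally compact, non-compact, separable metric space and T̄ = T ∪ {t_∞} its one-point compactification. Let v : T → (0, ∞) be continuous, let X = (X_t)_{t∈T} be a real-valued stochastic process with almost surely continuous sample paths such that almost surely v(t)·X_t → 0 along the cocompact filter of T, and let f : T → ℝ be continuous with v(t)·f(t) → 0 along the cocompact filter. Let u : T → ℝ be any function. Define X̄_t = v(t)·X_t and f̄(t) = v(t)·f(t) and ū(t) = v(t)·u(t) for t ∈ T, and X̄_{t_∞} = 0, f̄(t_∞) = 0, ū(t_∞) = min(liminf_{t → t_∞} v(t)·u(t), 0) (liminf along the cocompact filter). Then X̄ almost surely has continuous sample paths on T̄ and ℙ(∀ t ∈ T, X_t + f(t) ≤ u(t)) = ℙ(∀ t ∈ T̄, X̄_t + f̄(t) ≤ ū(t)). -/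
open MeasureTheory Filter

/-- A real function bounded below by a function tending to `0` has nonnegative `liminf`. This holds
even when the function is unbounded above, since the real `liminf` is then `0`. -/
theorem liminf_nonneg_of_tendsto_zero_le {α : Type*} {l : Filter α} {g w : α → ℝ}
    (hg : Tendsto g l (nhds 0)) (hgw : ∀ t, g t ≤ w t) : 0 ≤ liminf w l := by
  rw [liminf_eq]
  by_cases hbdd : BddAbove {a | ∀ᶠ t in l, a ≤ w t}
  · refine le_of_forall_lt fun a ha => ?_
    obtain ⟨b, hab, hb⟩ := exists_between ha
    refine hab.trans_le (le_csSup hbdd ?_)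
    filter_upwards [hg.eventually_const_lt hb] with t ht using ht.le.trans (hgw t)
  · rw [Real.sSup_of_not_bddAbove hbdd]

/-- Reduction to the one-point compactification: for a process `X` on a
locally compact, non-compact, separable metric space `T` and a continuous positive weight
`v` with `v·X → 0` at infinity a.s. and `v·f → 0` at infinity, the weighted process
`X̄ = v·X` (extended by `0` at `∞`) a.s. has continuous sample paths on `T̄ = T ∪ {∞}`, and
`ℙ(∀ t ∈ T, X_t + f(t) ≤ u(t)) = ℙ(∀ t ∈ T̄, X̄_t + f̄(t) ≤ ū(t))`, where `f̄ = v·f`,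
`ū = v·u` on `T`, `f̄(∞) = 0` and `ū(∞) = min(liminf_{t→∞} v(t)u(t), 0)`. -/
theorem onePoint_compactification_reduction
    (T : Type*) [MetricSpace T] [LocallyCompactSpace T] [NoncompactSpace T]
    [TopologicalSpace.SeparableSpace T]
    {Ω : Type*} [MeasurableSpace Ω] (P : Measure Ω) [IsProbabilityMeasure P]
    (v : T → ℝ) (hv : Continuous v) (hvpos : ∀ t, 0 < v t)
    (X : T → Ω → ℝ)
    (hXcont : ∀ᵐ ω ∂P, Continuous fun t => X t ω)
    (hXvan : ∀ᵐ ω ∂P, Tendsto (fun t => v t * X t ω) (cocompact T) (nhds 0))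
    (f : T → ℝ) (hf : Continuous f)
    (hfvan : Tendsto (fun t => v t * f t) (cocompact T) (nhds 0))
    (u : T → ℝ)
    (Xbar : OnePoint T → Ω → ℝ) (fbar ubar : OnePoint T → ℝ)
    (hXbar : ∀ (t : T) (ω : Ω), Xbar (t : OnePoint T) ω = v t * X t ω)
    (hXbarInf : ∀ ω : Ω, Xbar OnePoint.infty ω = 0)
    (hfbar : ∀ t : T, fbar (t : OnePoint T) = v t * f t)
    (hfbarInf : fbar OnePoint.infty = 0)
    (hubar : ∀ t : T, ubar (t : OnePoint T) = v t * u t)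
    (hubarInf : ubar OnePoint.infty =
      min (liminf (fun t => v t * u t) (cocompact T)) 0) :
    (∀ᵐ ω ∂P, Continuous fun t : OnePoint T => Xbar t ω) ∧
      P {ω | ∀ t : T, X t ω + f t ≤ u t} =
        P {ω | ∀ t : OnePoint T, Xbar t ω + fbar t ≤ ubar t} := by
  refine ⟨?_, measure_congr ?_⟩
  · filter_upwards [hXcont, hXvan] with ω hω hω0
    rw [OnePoint.continuous_iff]
    simp only [hXbar, hXbarInf, coclosedCompact_eq_cocompact]
    exact ⟨hω0, hv.mul hω⟩
  · filter_upwards [hXvan] with ω hω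
    refine propext ?_
    change (∀ t : T, X t ω + f t ≤ u t) ↔ ∀ t : OnePoint T, Xbar t ω + fbar t ≤ ubar t
    have hweight (t : T) : v t * X t ω + v t * f t ≤ v t * u t ↔ X t ω + f t ≤ u t := by
      rw [← mul_add, mul_le_mul_iff_right₀ (hvpos t)]
    rw [OnePoint.forall]
    simp only [hXbar, hfbar, hubar, hXbarInf, hfbarInf, hubarInf, hweight]
    refine ⟨fun h => ⟨?_, h⟩, And.right⟩
    have hlim : Tendsto (fun t => v t * X t ω + v t * f t) (cocompact T) (nhds 0) := by
      simpa using hω.add hfvan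
    simpa using liminf_nonneg_of_tendsto_zero_le hlim fun t => (hweight t).2 (h t)
end

section
/- Let b > 0 and let μ, ν be finite signed Borel measures on (0,b]. Define Jμ(s) := μ([s,b] ∩ (0,b]) for s ∈ [0,b]. Then: (i) for every t ∈ [0,b], ∫_{(0,b]} min(t,s) μ(ds) = ∫₀ᵗ Jμ(s) ds; and (ii) ∫_{(0,b]} ∫_{(0,b]} min(t,s) μ(ds) ν(dt) = ∫₀ᵇ Jμ(s)·Jν(s) ds. -/
open MeasureTheory Set

noncomputable section

/-- The integral of `f` over the set `A` with respect to the finite signed measure `μ`,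
defined via the Jordan decomposition `μ = μ⁺ − μ⁻`. -/
def signedIntegral (μ : SignedMeasure ℝ) (A : Set ℝ) (f : ℝ → ℝ) : ℝ :=
  (∫ x in A, f x ∂μ.toJordanDecomposition.posPart) -
    ∫ x in A, f x ∂μ.toJordanDecomposition.negPart

lemma integrable_indicator_le_prod (m : Measure ℝ) [IsFiniteMeasure m] {b : ℝ} {f : ℝ → ℝ}
    (hf : IntegrableOn f (Ioc 0 b)) :
    Integrable ({p : ℝ × ℝ | p.2 ≤ p.1}.indicator fun p => f p.2)
      ((m.restrict (Ioc 0 b)).prod (volume.restrict (Ioc 0 b))) :=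
  (hf.integrable.comp_snd _).indicator (measurableSet_le measurable_snd measurable_fst)

lemma integral_indicator_le_left {f : ℝ → ℝ} {b t : ℝ} (ht : t ∈ Ioc 0 b) :
    ∫ s in Ioc 0 b, {p : ℝ × ℝ | p.2 ≤ p.1}.indicator (fun p => f p.2) (t, s) =
      ∫ s in (0:ℝ)..t, f s := by
  have h : (fun s => {p : ℝ × ℝ | p.2 ≤ p.1}.indicator (fun p => f p.2) (t, s)) =
      (Iic t).indicator f := by
    ext s
    simp [indicator]
  rw [h, setIntegral_indicator measurableSet_Iic, intervalIntegral.integral_of_le ht.1.le,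
    Ioc_inter_Iic, min_eq_right ht.2]

lemma integral_indicator_le_right (m : Measure ℝ) {f : ℝ → ℝ} {b s : ℝ} :
    ∫ t in Ioc 0 b, {p : ℝ × ℝ | p.2 ≤ p.1}.indicator (fun p => f p.2) (t, s) ∂m =
      f s * m.real (Icc s b ∩ Ioc 0 b) := by
  have h : (fun t => {p : ℝ × ℝ | p.2 ≤ p.1}.indicator (fun p => f p.2) (t, s)) =
      (Ici s).indicator fun _ => f s := by
    ext t
    simp [indicator]
  have hset : Ioc 0 b ∩ Ici s = Icc s b ∩ Ioc 0 b := by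
    ext t
    simp only [mem_inter_iff, mem_Ioc, mem_Ici, mem_Icc]
    tauto
  rw [h, setIntegral_indicator measurableSet_Ici, hset, setIntegral_const, smul_eq_mul, mul_comm]

lemma intervalIntegrable_mul_tail (m : Measure ℝ) [IsFiniteMeasure m] {b : ℝ} (hb : 0 ≤ b)
    {f : ℝ → ℝ} (hf : IntervalIntegrable f volume 0 b) :
    IntervalIntegrable (fun s => f s * m.real (Icc s b ∩ Ioc 0 b)) volume 0 b := by
  rw [intervalIntegrable_iff_integrableOn_Ioc_of_le hb] at hf ⊢
  simpa only [IntegrableOn, integral_indicator_le_right] using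
    (integrable_indicator_le_prod m hf).integral_prod_right

lemma setIntegral_intervalIntegral_eq_tail (m : Measure ℝ) [IsFiniteMeasure m] {b : ℝ}
    (hb : 0 ≤ b) {f : ℝ → ℝ} (hf : IntervalIntegrable f volume 0 b) :
    ∫ t in Ioc 0 b, (∫ s in (0:ℝ)..t, f s) ∂m =
      ∫ s in (0:ℝ)..b, f s * m.real (Icc s b ∩ Ioc 0 b) := by
  rw [intervalIntegrable_iff_integrableOn_Ioc_of_le hb] at hf
  rw [intervalIntegral.integral_of_le hb]
  simp_rw [← integral_indicator_le_right m]
  rw [← integral_integral_swap (f := fun t s =>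
    {p : ℝ × ℝ | p.2 ≤ p.1}.indicator (fun p => f p.2) (t, s)) (integrable_indicator_le_prod m hf)]
  exact setIntegral_congr_fun measurableSet_Ioc fun t ht => (integral_indicator_le_left ht).symm

lemma signedMeasure_apply_eq_posPart_sub_negPart (μ : SignedMeasure ℝ) {A : Set ℝ}
    (hA : MeasurableSet A) :
    μ A = μ.toJordanDecomposition.posPart.real A - μ.toJordanDecomposition.negPart.real A := by
  conv_lhs => rw [← μ.toSignedMeasure_toJordanDecomposition]
  simp [JordanDecomposition.toSignedMeasure, Measure.toSignedMeasure_apply_measurable hA]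

lemma signedMeasure_tail_eq (μ : SignedMeasure ℝ) (b s : ℝ) :
    μ (Icc s b ∩ Ioc 0 b) = μ.toJordanDecomposition.posPart.real (Icc s b ∩ Ioc 0 b) -
      μ.toJordanDecomposition.negPart.real (Icc s b ∩ Ioc 0 b) :=
  signedMeasure_apply_eq_posPart_sub_negPart μ (measurableSet_Icc.inter measurableSet_Ioc)

lemma intervalIntegrable_signedMeasure_tail (μ : SignedMeasure ℝ) {b : ℝ} (hb : 0 ≤ b) :
    IntervalIntegrable (fun s => μ (Icc s b ∩ Ioc 0 b)) volume 0 b := by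
  have h (m : Measure ℝ) [IsFiniteMeasure m] :
      IntervalIntegrable (fun s => m.real (Icc s b ∩ Ioc 0 b)) volume 0 b := by
    simpa using intervalIntegrable_mul_tail m hb
      (intervalIntegrable_const (c := (1 : ℝ)) (μ := volume) (a := 0) (b := b))
  simp_rw [signedMeasure_tail_eq]
  exact (h _).sub (h _)

lemma signedIntegral_intervalIntegral_eq_tail (μ : SignedMeasure ℝ) {b : ℝ} (hb : 0 ≤ b)
    {f : ℝ → ℝ} (hf : IntervalIntegrable f volume 0 b) :
    signedIntegral μ (Ioc 0 b) (fun t => ∫ s in (0:ℝ)..t, f s) =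
      ∫ s in (0:ℝ)..b, f s * μ (Icc s b ∩ Ioc 0 b) := by
  simp_rw [signedMeasure_tail_eq, mul_sub]
  rw [intervalIntegral.integral_sub (intervalIntegrable_mul_tail _ hb hf)
    (intervalIntegrable_mul_tail _ hb hf), signedIntegral,
    setIntegral_intervalIntegral_eq_tail _ hb hf, setIntegral_intervalIntegral_eq_tail _ hb hf]

lemma signedIntegral_congr (μ : SignedMeasure ℝ) {A : Set ℝ} (hA : MeasurableSet A)
    {f g : ℝ → ℝ} (h : EqOn f g A) : signedIntegral μ A f = signedIntegral μ A g := by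
  rw [signedIntegral, signedIntegral, setIntegral_congr_fun hA h, setIntegral_congr_fun hA h]

lemma intervalIntegral_indicator_Iic {f : ℝ → ℝ} {t x : ℝ} (ht : 0 ≤ t) (hx : 0 ≤ x) :
    ∫ s in (0:ℝ)..x, (Iic t).indicator f s = ∫ s in (0:ℝ)..min t x, f s := by
  rw [intervalIntegral.integral_of_le hx, intervalIntegral.integral_of_le (le_min ht hx),
    setIntegral_indicator measurableSet_Iic, Ioc_inter_Iic, inf_comm]

lemma signedIntegral_min_eq (μ : SignedMeasure ℝ) {b t : ℝ} (ht : t ∈ Icc 0 b) :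
    signedIntegral μ (Ioc 0 b) (fun s => min t s) =
      ∫ s in (0:ℝ)..t, μ (Icc s b ∩ Ioc 0 b) := by
  have hb : 0 ≤ b := ht.1.trans ht.2
  have hf : IntervalIntegrable ((Iic t).indicator fun _ => (1 : ℝ)) volume 0 b := by
    rw [intervalIntegrable_iff_integrableOn_Ioc_of_le hb]
    exact (integrable_const (1 : ℝ)).indicator measurableSet_Iic
  have hmin : EqOn (fun x => min t x)
      (fun x => ∫ s in (0:ℝ)..x, (Iic t).indicator (fun _ => (1 : ℝ)) s) (Ioc 0 b) := by
    intro x hx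
    simp [intervalIntegral_indicator_Iic ht.1 hx.1.le]
  rw [signedIntegral_congr μ measurableSet_Ioc hmin,
    signedIntegral_intervalIntegral_eq_tail μ hb hf]
  have hmul (s : ℝ) : (Iic t).indicator (fun _ => (1 : ℝ)) s * μ (Icc s b ∩ Ioc 0 b) =
      (Iic t).indicator (fun s => μ (Icc s b ∩ Ioc 0 b)) s := by
    simp [indicator]
  simp_rw [hmul]
  rw [intervalIntegral_indicator_Iic ht.1 hb, min_eq_left ht.2]

/-- Let `μ, ν` be finite signed Borel measures on `(0, b]` and
`Jμ(s) = μ([s,b] ∩ (0,b])`. Then (i) for every `t ∈ [0, b]`,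
`∫_{(0,b]} min(t,s) μ(ds) = ∫₀ᵗ Jμ(s) ds`, and (ii)
`∫_{(0,b]} ∫_{(0,b]} min(t,s) μ(ds) ν(dt) = ∫₀ᵇ Jμ(s)·Jν(s) ds`. -/
theorem wiener_covariance_operator_formulas
    (b : ℝ) (hb : 0 < b)
    (μ ν : SignedMeasure ℝ)
    (hμsupp : ∀ A : Set ℝ, MeasurableSet A → μ A = μ (A ∩ Ioc 0 b))
    (hνsupp : ∀ A : Set ℝ, MeasurableSet A → ν A = ν (A ∩ Ioc 0 b)) :
    (∀ t ∈ Icc 0 b,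
      signedIntegral μ (Ioc 0 b) (fun s => min t s) =
        ∫ s in (0:ℝ)..t, μ (Icc s b ∩ Ioc 0 b)) ∧
    signedIntegral ν (Ioc 0 b)
        (fun t => signedIntegral μ (Ioc 0 b) (fun s => min t s)) =
      ∫ s in (0:ℝ)..b, μ (Icc s b ∩ Ioc 0 b) * ν (Icc s b ∩ Ioc 0 b) := by
  refine ⟨fun t ht => signedIntegral_min_eq μ ht, ?_⟩
  rw [signedIntegral_congr ν measurableSet_Ioc
    fun t ht => signedIntegral_min_eq μ (Ioc_subset_Icc_self ht)]
  exact signedIntegral_intervalIntegral_eq_tail ν hb.le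
    (intervalIntegrable_signedMeasure_tail μ hb.le)

end
end

section
/- Let T > 0 and let μ, ν be finite signed Borel measures on (0,T]². Define J₂μ(u₁,u₂) := μ(([u₁,T]×[u₂,T]) ∩ (0,T]²) for (u₁,u₂) ∈ [0,T]². Then ∫_{(0,T]²} ∫_{(0,T]²} min(t₁,s₁)·min(t₂,s₂) μ(d s₁, d s₂) ν(d t₁, d t₂) = ∫_{[0,T]²} J₂μ(u₁,u₂)·J₂ν(u₁,u₂) du₁ du₂; moreover, for every (t₁,t₂) ∈ [0,T]², ∫_{(0,T]²} min(t₁,s₁)·min(t₂,s₂) μ(d s₁, d s₂) = ∫₀^{t₁} ∫₀^{t₂} J₂μ(u₁,u₂) du₂ du₁. -/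
open MeasureTheory Set

noncomputable section

/-- The integral of `f` over the set `A` with respect to the finite signed measure `μ`
on `ℝ²`, defined via the Jordan decomposition `μ = μ⁺ − μ⁻`. -/
def signedIntegral2 (μ : SignedMeasure (ℝ × ℝ)) (A : Set (ℝ × ℝ))
    (f : ℝ × ℝ → ℝ) : ℝ :=
  (∫ x in A, f x ∂μ.toJordanDecomposition.posPart) -
    ∫ x in A, f x ∂μ.toJordanDecomposition.negPart

/-- Fubini for the order relation: integrating the distribution function of `g` against `n`
is integrating `g` against the survival function of `n`. -/
theorem integral_setIntegral_Iic_eq_integral_mul_measureReal_Ici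
    (n l : Measure (ℝ × ℝ)) [IsFiniteMeasure n] [SFinite l]
    {g : ℝ × ℝ → ℝ} (hg : Integrable g l) :
    ∫ t, (∫ u in Iic t, g u ∂l) ∂n = ∫ u, g u * n.real (Ici u) ∂l := by
  have hint : Integrable (Function.uncurry fun t u => (Iic t).indicator g u) (n.prod l) := by
    have hset : MeasurableSet {q : (ℝ × ℝ) × (ℝ × ℝ) | q.2 ≤ q.1} :=
      measurableSet_le measurable_snd measurable_fst
    refine ((hg.comp_snd n).indicator hset).congr (ae_of_all _ fun q => ?_)
    simp [Function.uncurry, indicator]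
  calc ∫ t, (∫ u in Iic t, g u ∂l) ∂n
      = ∫ t, ∫ u, (Iic t).indicator g u ∂l ∂n := by
        simp only [integral_indicator measurableSet_Iic]
    _ = ∫ u, ∫ t, (Iic t).indicator g u ∂n ∂l := integral_integral_swap hint
    _ = ∫ u, g u * n.real (Ici u) ∂l := by
        refine integral_congr_ae (ae_of_all _ fun u => ?_)
        have h : (fun t => (Iic t).indicator g u) = (Ici u).indicator fun _ => g u := by
          ext t
          simp [indicator]
        simp only [h, integral_indicator_const _ measurableSet_Ici, smul_eq_mul, mul_comm]

theorem measurable_measureReal_Ici (n : Measure (ℝ × ℝ)) [SFinite n] :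
    Measurable fun u => n.real (Ici u) := by
  have hset : MeasurableSet {q : (ℝ × ℝ) × (ℝ × ℝ) | q.1 ≤ q.2} :=
    measurableSet_le measurable_fst measurable_snd
  exact (measurable_measure_prodMk_left hset).ennreal_toReal

theorem integrable_measureReal_Ici (n l : Measure (ℝ × ℝ)) [IsFiniteMeasure n]
    [IsFiniteMeasure l] : Integrable (fun u => n.real (Ici u)) l := by
  refine Integrable.of_bound (measurable_measureReal_Ici n).aestronglyMeasurable (n.real univ)
    (ae_of_all _ fun u => ?_)
  rw [Real.norm_of_nonneg measureReal_nonneg]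
  exact measureReal_mono (subset_univ _)

theorem signedMeasure_apply_eq_measureReal_sub {α : Type*} [MeasurableSpace α]
    (μ : SignedMeasure α) {A : Set α} (hA : MeasurableSet A) :
    μ A = μ.toJordanDecomposition.posPart.real A - μ.toJordanDecomposition.negPart.real A := by
  conv_lhs => rw [← μ.toSignedMeasure_toJordanDecomposition]
  simp [JordanDecomposition.toSignedMeasure, Measure.toSignedMeasure_apply_measurable hA]

theorem Icc_prod_inter_Ioc_prod_eq (T : ℝ) (p : ℝ × ℝ) :
    Icc p.1 T ×ˢ Icc p.2 T ∩ Ioc 0 T ×ˢ Ioc 0 T = Ici p ∩ Ioc 0 T ×ˢ Ioc 0 T := by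
  ext s
  simp only [mem_inter_iff, mem_prod, mem_Icc, mem_Ioc, mem_Ici, Prod.le_def]
  tauto

theorem signedMeasure_quadrant_eq (T : ℝ) (μ : SignedMeasure (ℝ × ℝ)) (p : ℝ × ℝ) :
    μ (Icc p.1 T ×ˢ Icc p.2 T ∩ Ioc 0 T ×ˢ Ioc 0 T) =
      (μ.toJordanDecomposition.posPart.restrict (Ioc 0 T ×ˢ Ioc 0 T)).real (Ici p) -
        (μ.toJordanDecomposition.negPart.restrict (Ioc 0 T ×ˢ Ioc 0 T)).real (Ici p) := by
  rw [Icc_prod_inter_Ioc_prod_eq, signedMeasure_apply_eq_measureReal_sub μ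
      (measurableSet_Ici.inter (measurableSet_Ioc.prod measurableSet_Ioc)),
    measureReal_restrict_apply measurableSet_Ici, measureReal_restrict_apply measurableSet_Ici]

theorem integrable_signedMeasure_quadrant (T : ℝ) (μ : SignedMeasure (ℝ × ℝ))
    (l : Measure (ℝ × ℝ)) [IsFiniteMeasure l] :
    Integrable (fun p => μ (Icc p.1 T ×ˢ Icc p.2 T ∩ Ioc 0 T ×ˢ Ioc 0 T)) l := by
  simp only [signedMeasure_quadrant_eq]
  exact (integrable_measureReal_Ici _ _).sub (integrable_measureReal_Ici _ _)

theorem integrable_mul_measureReal_Ici (n l : Measure (ℝ × ℝ)) [IsFiniteMeasure n]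
    {g : ℝ × ℝ → ℝ} (hg : Integrable g l) : Integrable (fun u => g u * n.real (Ici u)) l := by
  refine hg.mul_bdd (c := n.real univ) (measurable_measureReal_Ici n).aestronglyMeasurable
    (ae_of_all _ fun u => ?_)
  rw [Real.norm_of_nonneg measureReal_nonneg]
  exact measureReal_mono (subset_univ _)

theorem signedIntegral2_setIntegral_Iic (T : ℝ) (ν : SignedMeasure (ℝ × ℝ))
    (l : Measure (ℝ × ℝ)) [SFinite l] {g : ℝ × ℝ → ℝ} (hg : Integrable g l) :
    signedIntegral2 ν (Ioc 0 T ×ˢ Ioc 0 T) (fun t => ∫ u in Iic t, g u ∂l) =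
      ∫ p, g p * ν (Icc p.1 T ×ˢ Icc p.2 T ∩ Ioc 0 T ×ˢ Ioc 0 T) ∂l := by
  simp only [signedIntegral2, integral_setIntegral_Iic_eq_integral_mul_measureReal_Ici _ l hg,
    signedMeasure_quadrant_eq, mul_sub]
  exact (integral_sub (integrable_mul_measureReal_Ici _ l hg)
    (integrable_mul_measureReal_Ici _ l hg)).symm

theorem signedIntegral2_congr (ν : SignedMeasure (ℝ × ℝ)) {A : Set (ℝ × ℝ)}
    (hA : MeasurableSet A) {f g : ℝ × ℝ → ℝ} (h : EqOn f g A) :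
    signedIntegral2 ν A f = signedIntegral2 ν A g := by
  simp only [signedIntegral2, setIntegral_congr_fun hA h]

theorem Iic_inter_Icc_prod_eq {T : ℝ} {t : ℝ × ℝ} (ht : t ∈ Icc (0 : ℝ) T ×ˢ Icc (0 : ℝ) T) :
    Iic t ∩ Icc (0 : ℝ) T ×ˢ Icc (0 : ℝ) T = Icc 0 t.1 ×ˢ Icc 0 t.2 := by
  obtain ⟨⟨_, h1⟩, ⟨_, h2⟩⟩ := ht
  ext u
  simp only [mem_inter_iff, mem_prod, mem_Icc, mem_Iic, Prod.le_def]
  constructor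
  · tauto
  · rintro ⟨⟨a, b⟩, c, d⟩
    exact ⟨⟨b, d⟩, ⟨a, b.trans h1⟩, c, d.trans h2⟩

theorem min_mul_min_eq_setIntegral {T : ℝ} {t s : ℝ × ℝ}
    (ht : t ∈ Icc (0 : ℝ) T ×ˢ Icc (0 : ℝ) T) (hs : s ∈ Icc (0 : ℝ) T ×ˢ Icc (0 : ℝ) T) :
    min t.1 s.1 * min t.2 s.2 =
      ∫ u in Iic s, (Iic t).indicator (fun _ => (1 : ℝ)) u
        ∂(volume.restrict (Icc (0 : ℝ) T ×ˢ Icc (0 : ℝ) T)) := by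
  have hset : Iic t ∩ (Iic s ∩ Icc (0 : ℝ) T ×ˢ Icc (0 : ℝ) T) =
      Icc 0 (min t.1 s.1) ×ˢ Icc 0 (min t.2 s.2) := by
    rw [Iic_inter_Icc_prod_eq hs]
    ext u
    simp only [mem_inter_iff, mem_prod, mem_Icc, mem_Iic, Prod.le_def, le_min_iff]
    tauto
  rw [Measure.restrict_restrict measurableSet_Iic, integral_indicator_const _ measurableSet_Iic,
    measureReal_restrict_apply measurableSet_Iic, hset, Measure.volume_eq_prod,
    measureReal_prod_prod, Real.volume_real_Icc_of_le (le_min ht.1.1 hs.1.1),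
    Real.volume_real_Icc_of_le (le_min ht.2.1 hs.2.1)]
  simp

theorem signedIntegral2_min_mul_min_eq_setIntegral {T : ℝ} (μ : SignedMeasure (ℝ × ℝ))
    {t : ℝ × ℝ} (ht : t ∈ Icc (0 : ℝ) T ×ˢ Icc (0 : ℝ) T) :
    signedIntegral2 μ (Ioc 0 T ×ˢ Ioc 0 T) (fun s => min t.1 s.1 * min t.2 s.2) =
      ∫ p in Iic t, μ (Icc p.1 T ×ˢ Icc p.2 T ∩ Ioc 0 T ×ˢ Ioc 0 T)
        ∂(volume.restrict (Icc (0 : ℝ) T ×ˢ Icc (0 : ℝ) T)) := by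
  have : IsFiniteMeasure ((volume : Measure (ℝ × ℝ)).restrict
      (Icc (0 : ℝ) T ×ˢ Icc (0 : ℝ) T)) :=
    isFiniteMeasure_restrict.2 (isCompact_Icc.prod isCompact_Icc).measure_ne_top
  rw [signedIntegral2_congr μ (measurableSet_Ioc.prod measurableSet_Ioc) fun s hs =>
      min_mul_min_eq_setIntegral ht (prod_mono Ioc_subset_Icc_self Ioc_subset_Icc_self hs),
    signedIntegral2_setIntegral_Iic T μ _
      ((integrable_const (1 : ℝ)).indicator measurableSet_Iic),
    ← integral_indicator measurableSet_Iic]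
  refine integral_congr_ae (ae_of_all _ fun p => ?_)
  by_cases hp : p ∈ Iic t <;> simp only [hp, indicator_of_mem, indicator_of_notMem,
    not_false_eq_true, one_mul, zero_mul]

/-- Let `μ, ν` be finite signed Borel measures on `(0, T]²` and
`J₂μ(u₁,u₂) = μ(([u₁,T]×[u₂,T]) ∩ (0,T]²)`. Then
`∫∫ min(t₁,s₁) min(t₂,s₂) μ(ds) ν(dt) = ∫_{[0,T]²} J₂μ·J₂ν`, and for every
`(t₁,t₂) ∈ [0,T]²`,
`∫ min(t₁,s₁) min(t₂,s₂) μ(ds) = ∫₀^{t₁} ∫₀^{t₂} J₂μ(u₁,u₂) du₂ du₁`. -/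
theorem brownianSheet_covariance_operator_formulas
    (T : ℝ) (hT : 0 < T)
    (μ ν : SignedMeasure (ℝ × ℝ))
    (hμsupp : ∀ A : Set (ℝ × ℝ), MeasurableSet A →
      μ A = μ (A ∩ Ioc 0 T ×ˢ Ioc 0 T))
    (hνsupp : ∀ A : Set (ℝ × ℝ), MeasurableSet A →
      ν A = ν (A ∩ Ioc 0 T ×ˢ Ioc 0 T)) :
    signedIntegral2 ν (Ioc 0 T ×ˢ Ioc 0 T)
        (fun t => signedIntegral2 μ (Ioc 0 T ×ˢ Ioc 0 T)
          (fun s => min t.1 s.1 * min t.2 s.2)) =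
      (∫ p in Icc (0:ℝ) T ×ˢ Icc (0:ℝ) T,
        μ (Icc p.1 T ×ˢ Icc p.2 T ∩ Ioc 0 T ×ˢ Ioc 0 T) *
          ν (Icc p.1 T ×ˢ Icc p.2 T ∩ Ioc 0 T ×ˢ Ioc 0 T)) ∧
    ∀ t ∈ Icc (0:ℝ) T ×ˢ Icc (0:ℝ) T,
      signedIntegral2 μ (Ioc 0 T ×ˢ Ioc 0 T)
          (fun s => min t.1 s.1 * min t.2 s.2) =
        ∫ u₁ in (0:ℝ)..t.1, ∫ u₂ in (0:ℝ)..t.2,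
          μ (Icc u₁ T ×ˢ Icc u₂ T ∩ Ioc 0 T ×ˢ Ioc 0 T) := by
  have hfin : IsFiniteMeasure ((volume : Measure (ℝ × ℝ)).restrict
      (Icc (0 : ℝ) T ×ˢ Icc (0 : ℝ) T)) :=
    isFiniteMeasure_restrict.2 (isCompact_Icc.prod isCompact_Icc).measure_ne_top
  refine ⟨?_, fun t ht => ?_⟩
  · rw [signedIntegral2_congr ν (measurableSet_Ioc.prod measurableSet_Ioc) fun t ht =>
      signedIntegral2_min_mul_min_eq_setIntegral μ
        (prod_mono Ioc_subset_Icc_self Ioc_subset_Icc_self ht)]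
    exact signedIntegral2_setIntegral_Iic T ν _ (integrable_signedMeasure_quadrant T μ _)
  · have hint : IntegrableOn (fun p : ℝ × ℝ =>
        μ (Icc p.1 T ×ˢ Icc p.2 T ∩ Ioc 0 T ×ˢ Ioc 0 T)) (Icc 0 t.1 ×ˢ Icc 0 t.2) := by
      rw [← Iic_inter_Icc_prod_eq ht]
      exact IntegrableOn.mono_set (integrable_signedMeasure_quadrant T μ _) inter_subset_right
    rw [signedIntegral2_min_mul_min_eq_setIntegral μ ht,
      Measure.restrict_restrict measurableSet_Iic, Iic_inter_Icc_prod_eq ht,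
      Measure.volume_eq_prod, setIntegral_prod _ hint,
      intervalIntegral.integral_of_le ht.1.1, integral_Icc_eq_integral_Ioc]
    simp only [intervalIntegral.integral_of_le ht.2.1, integral_Icc_eq_integral_Ioc]

end
end
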